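/- Let (a₁,a₂) and (b₁,b₂) be feasible two-robot configurations with (a₁,a₂) ∈ F↑ (y(a₁) ≥ y(a₂)+1) and (b₁,b₂) ∈ F→ (x(b₁) ≥ x(b₂)+1), and let I = (i₁,i₂) be any feasible diagonal configuration, i.e. one with x(i₁) ≥ x(i₂)+1 and y(i₁) ≥ y(i₂)+1. Then there exist T ≥ 0 and a feasible schedule (m₁,m₂) from (a₁,a₂) to (b₁,b₂) over [0,T] passing through I such that for each i ∈ {1,2} the L1 length of mᵢ over [0,T] equals ‖aᵢ − iᵢ‖₁ + ‖iᵢ − bᵢ‖₁; in particular the total traveled length equals (‖a₁ − i₁‖₁ + ‖i₁ − b₁‖₁) + (‖a₂ − i₂‖₁ + ‖i₂ − b₂‖₁). -/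

import Mathlib

/-- The L1 norm of a point of the plane. -/
noncomputable def l1 (p : ℝ × ℝ) : ℝ := |p.1| + |p.2|

/-- Two unit-square robots centered at `p₁`, `p₂` are interior disjoint. -/
def Feasible2 (p₁ p₂ : ℝ × ℝ) : Prop := max |p₁.1 - p₂.1| |p₁.2 - p₂.2| ≥ 1

/-- `m` is 1-Lipschitz on `[0, T]` with respect to the L1 distance. -/
def Lip1On (m : ℝ → ℝ × ℝ) (T : ℝ) : Prop :=
  ∀ s ∈ Set.Icc (0:ℝ) T, ∀ t ∈ Set.Icc (0:ℝ) T, l1 (m s - m t) ≤ |s - t|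

/-- `(m₁, m₂)` is a feasible schedule from `(a₁,a₂)` to `(b₁,b₂)` over `[0,T]`. -/
def IsSchedule2 (m₁ m₂ : ℝ → ℝ × ℝ) (a₁ a₂ b₁ b₂ : ℝ × ℝ) (T : ℝ) : Prop :=
  0 ≤ T ∧ m₁ 0 = a₁ ∧ m₂ 0 = a₂ ∧ m₁ T = b₁ ∧ m₂ T = b₂ ∧
  Lip1On m₁ T ∧ Lip1On m₂ T ∧
  ∀ t ∈ Set.Icc (0:ℝ) T, Feasible2 (m₁ t) (m₂ t)

/-- The L1 length of a trajectory over `[0,T]`: its total variation on `[0,T]`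
with respect to the L1 distance on the plane. -/
noncomputable def l1Length (m : ℝ → ℝ × ℝ) (T : ℝ) : ENNReal :=
  eVariationOn (fun t => (WithLp.equiv 1 (ℝ × ℝ)).symm (m t)) (Set.Icc 0 T)

theorem l1_dist (p q : ℝ × ℝ) :
    edist ((WithLp.equiv 1 (ℝ × ℝ)).symm p) ((WithLp.equiv 1 (ℝ × ℝ)).symm q)
      = ENNReal.ofReal (l1 (p - q)) := by
  rw [edist_dist]
  congr 1
  rw [WithLp.prod_dist_eq_of_L1]
  simp [l1, Real.dist_eq]

theorem l1_smul (c : ℝ) (p : ℝ × ℝ) : l1 (c • p) = |c| * l1 p := by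
  simp [l1, abs_mul, mul_add]

theorem l1_nonneg (p : ℝ × ℝ) : 0 ≤ l1 p := by unfold l1; positivity

theorem l1_symm (p q : ℝ × ℝ) : l1 (p - q) = l1 (q - p) := by
  simp [l1, abs_sub_comm]

theorem l1_add (p q : ℝ × ℝ) : l1 (p + q) ≤ l1 p + l1 q := by
  have h1 := abs_add_le p.1 q.1
  have h2 := abs_add_le p.2 q.2
  simp only [l1, Prod.fst_add, Prod.snd_add]; linarith

theorem seg_var (f : ℝ → ℝ × ℝ) (p q : ℝ × ℝ) (u w K : ℝ) (hK : 0 < K) (hw : w = u + K)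
    (hf : ∀ t ∈ Set.Icc u w, f t = p + ((t - u) / K) • (q - p)) :
    eVariationOn (fun t => (WithLp.equiv 1 (ℝ × ℝ)).symm (f t)) (Set.Icc u w)
      = ENNReal.ofReal (l1 (p - q)) := by
  have huw : u ≤ w := by linarith
  have e : Set.EqOn (fun t => (WithLp.equiv 1 (ℝ × ℝ)).symm (f t))
      ((fun s : ℝ => (WithLp.equiv 1 (ℝ × ℝ)).symm (p + s • (q - p))) ∘ (fun t => (t - u) / K))
      (Set.Icc u w) := by
    intro t ht
    simp only [Function.comp, hf t ht]
  apply le_antisymm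
  · rw [eVariationOn.congr e]
    have hL : LipschitzOnWith (Real.toNNReal (l1 (q - p)))
        (fun s : ℝ => (WithLp.equiv 1 (ℝ × ℝ)).symm (p + s • (q - p))) Set.univ := by
      intro s _ t _
      rw [l1_dist]
      have : p + s • (q - p) - (p + t • (q - p)) = (s - t) • (q - p) := by module
      rw [this, l1_smul, edist_dist, Real.dist_eq, mul_comm,
        ENNReal.ofReal_mul (l1_nonneg _)]
      rfl
    refine (hL.comp_eVariationOn_le (fun _ _ => Set.mem_univ _)).trans ?_
    have hm : MonotoneOn (fun t : ℝ => (t - u) / K) (Set.Icc u w) := by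
      intro s _ t _ h
      simp only
      gcongr
    have := (hm.eVariationOn_eq (Set.left_mem_Icc.2 huw) (Set.right_mem_Icc.2 huw)).le
    rw [Set.inter_self] at this
    have h1 : (w - u) / K - (u - u) / K = 1 := by
      rw [hw]; field_simp; ring
    rw [h1] at this
    rw [l1_symm p q]
    calc _ ≤ ENNReal.ofReal (l1 (q - p)) * ENNReal.ofReal 1 := mul_le_mul' le_rfl this
      _ = _ := by simp
  · have := eVariationOn.edist_le (fun t => (WithLp.equiv 1 (ℝ × ℝ)).symm (f t))
      (Set.left_mem_Icc.2 huw) (Set.right_mem_Icc.2 huw)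
    rw [l1_dist, hf u (Set.left_mem_Icc.2 huw), hf w (Set.right_mem_Icc.2 huw)] at this
    have h1 : (w - u) / K = 1 := by rw [hw]; field_simp; ring
    simpa [h1] using this

/-- Move linearly from `a` to `i` during `[0,K]`, then from `i` to `b` during `[K,2K]`. -/
noncomputable def traj (K : ℝ) (a i b : ℝ × ℝ) (t : ℝ) : ℝ × ℝ :=
  a + (min (t / K) 1) • (i - a) + (max (t / K - 1) 0) • (b - i)

theorem traj_left {K : ℝ} (hK : 0 < K) (a i b : ℝ × ℝ) {t : ℝ} (ht : t ≤ K) :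
    traj K a i b t = a + (t / K) • (i - a) := by
  have : t / K ≤ 1 := (div_le_one hK).2 ht
  rw [traj, min_eq_left this, max_eq_right (by linarith)]; simp

theorem traj_right {K : ℝ} (hK : 0 < K) (a i b : ℝ × ℝ) {t : ℝ} (ht : K ≤ t) :
    traj K a i b t = i + ((t - K) / K) • (b - i) := by
  have : 1 ≤ t / K := (one_le_div hK).2 ht
  have h2 : (t - K) / K = t / K - 1 := by field_simp
  rw [traj, min_eq_right this, max_eq_left (by linarith), h2]; simp

theorem traj_length {K : ℝ} (hK : 0 < K) (a i b : ℝ × ℝ) :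
    l1Length (traj K a i b) (2 * K) = ENNReal.ofReal (l1 (a - i) + l1 (i - b)) := by
  have h := eVariationOn.Icc_add_Icc
    (fun t => (WithLp.equiv 1 (ℝ × ℝ)).symm (traj K a i b t)) (s := Set.univ)
    hK.le (show K ≤ 2 * K by linarith) (Set.mem_univ _)
  simp only [Set.univ_inter] at h
  rw [l1Length, ← h, ENNReal.ofReal_add (l1_nonneg _) (l1_nonneg _)]
  congr 1
  · refine seg_var _ a i 0 K K hK (by ring) fun t ht => ?_
    rw [traj_left hK a i b ht.2, sub_zero]
  · exact seg_var _ i b K (2 * K) K hK (by ring) fun t ht => traj_right hK a i b ht.1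

theorem traj_lip {K : ℝ} (hK : 0 < K) (a i b : ℝ × ℝ) (h1 : l1 (i - a) ≤ K)
    (h2 : l1 (b - i) ≤ K) (T : ℝ) : Lip1On (traj K a i b) T := by
  have key : ∀ s t : ℝ, t ≤ s → l1 (traj K a i b s - traj K a i b t) ≤ s - t := by
    intro s t hst
    have e : traj K a i b s - traj K a i b t =
        (min (s / K) 1 - min (t / K) 1) • (i - a)
        + (max (s / K - 1) 0 - max (t / K - 1) 0) • (b - i) := by
      simp only [traj]; module
    have hd : t / K ≤ s / K := by gcongr
    have n1 : 0 ≤ min (s / K) 1 - min (t / K) 1 :=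
      sub_nonneg.2 (min_le_min_right _ hd)
    have n2 : 0 ≤ max (s / K - 1) 0 - max (t / K - 1) 0 :=
      sub_nonneg.2 (max_le_max_right _ (by linarith))
    have id : ∀ x : ℝ, min x 1 + max (x - 1) 0 = x := by
      intro x
      rcases le_total x 1 with h | h
      · rw [min_eq_left h, max_eq_right (by linarith)]; ring
      · rw [min_eq_right h, max_eq_left (by linarith)]; ring
    rw [e]
    refine (l1_add _ _).trans ?_
    rw [l1_smul, l1_smul, abs_of_nonneg n1, abs_of_nonneg n2]
    have m1 := mul_le_mul_of_nonneg_left h1 n1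
    have m2 := mul_le_mul_of_nonneg_left h2 n2
    have hs := id (s / K)
    have ht := id (t / K)
    have hsum : (min (s / K) 1 - min (t / K) 1) * K
        + (max (s / K - 1) 0 - max (t / K - 1) 0) * K = s - t := by
      have : (min (s / K) 1 - min (t / K) 1) + (max (s / K - 1) 0 - max (t / K - 1) 0)
        = s / K - t / K := by linarith
      rw [← add_mul, this]; field_simp
    linarith
  intro s _ t _
  rcases le_total t s with h | h
  · rw [abs_of_nonneg (by linarith)]; exact key s t h
  · rw [abs_sub_comm, l1_symm, abs_of_nonneg (by linarith)]; exact key t s h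

theorem conv_ge {p q r s c : ℝ} (h0 : 0 ≤ c) (h1 : c ≤ 1) (hp : p ≥ q + 1) (hr : r ≥ s + 1) :
    1 ≤ (p + c * (r - p)) - (q + c * (s - q)) := by
  nlinarith [mul_nonneg h0 (sub_nonneg.2 hr), mul_nonneg (sub_nonneg.2 h1) (sub_nonneg.2 hp)]

theorem stmt13 (a₁ a₂ b₁ b₂ i₁ i₂ : ℝ × ℝ)
    (hA : Feasible2 a₁ a₂) (hB : Feasible2 b₁ b₂) (hI : Feasible2 i₁ i₂)
    (hAup : a₁.2 ≥ a₂.2 + 1) (hBright : b₁.1 ≥ b₂.1 + 1)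
    (hIx : i₁.1 ≥ i₂.1 + 1) (hIy : i₁.2 ≥ i₂.2 + 1) :
    ∃ T ≥ (0:ℝ), ∃ m₁ m₂ : ℝ → ℝ × ℝ, IsSchedule2 m₁ m₂ a₁ a₂ b₁ b₂ T ∧
      (∃ t ∈ Set.Icc (0:ℝ) T, m₁ t = i₁ ∧ m₂ t = i₂) ∧
      l1Length m₁ T = ENNReal.ofReal (l1 (a₁ - i₁) + l1 (i₁ - b₁)) ∧
      l1Length m₂ T = ENNReal.ofReal (l1 (a₂ - i₂) + l1 (i₂ - b₂)) := by
  obtain ⟨K, hK, k1, k2, k3, k4⟩ : ∃ K : ℝ, 0 < K ∧ l1 (i₁ - a₁) ≤ K ∧ l1 (b₁ - i₁) ≤ K ∧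
      l1 (i₂ - a₂) ≤ K ∧ l1 (b₂ - i₂) ≤ K := by
    have := l1_nonneg (i₁ - a₁)
    have := l1_nonneg (b₁ - i₁)
    have := l1_nonneg (i₂ - a₂)
    have := l1_nonneg (b₂ - i₂)
    refine ⟨l1 (i₁ - a₁) + l1 (b₁ - i₁) + l1 (i₂ - a₂) + l1 (b₂ - i₂) + 1, ?_, ?_, ?_, ?_, ?_⟩ <;>
      linarith
  have start : ∀ a i b : ℝ × ℝ, traj K a i b 0 = a := fun a i b => by
    rw [traj_left hK a i b hK.le]; simp
  have mid : ∀ a i b : ℝ × ℝ, traj K a i b K = i := fun a i b => by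
    rw [traj_right hK a i b le_rfl]; simp
  have fin : ∀ a i b : ℝ × ℝ, traj K a i b (2 * K) = b := fun a i b => by
    have : (2 * K - K) / K = 1 := by field_simp; ring
    rw [traj_right hK a i b (by linarith), this]; simp
  refine ⟨2 * K, by linarith, traj K a₁ i₁ b₁, traj K a₂ i₂ b₂,
    ⟨by linarith, start _ _ _, start _ _ _, fin _ _ _, fin _ _ _,
      traj_lip hK _ _ _ k1 k2 _, traj_lip hK _ _ _ k3 k4 _, ?_⟩,
    ⟨K, ⟨hK.le, by linarith⟩, mid _ _ _, mid _ _ _⟩, traj_length hK _ _ _, traj_length hK _ _ _⟩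
  intro t ht
  rcases le_total t K with h | h
  · rw [traj_left hK _ _ _ h, traj_left hK _ _ _ h]
    have := conv_ge (div_nonneg ht.1 hK.le) ((div_le_one hK).2 h) hAup hIy
    exact le_max_of_le_right (le_trans (by simpa using this) (le_abs_self _))
  · rw [traj_right hK _ _ _ h, traj_right hK _ _ _ h]
    have := conv_ge (c := (t - K) / K) (div_nonneg (by linarith) hK.le)
      ((div_le_one hK).2 (by linarith [ht.2])) hIx hBright
    exact le_max_of_le_left (le_trans (by simpa using this) (le_abs_self _))
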